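/- arXiv:quant-ph/0611147 — 2 statements merged into one kernel-verified Lean document; each statement's English description precedes it below -/
import Mathlib

section
/- For t ∈ {0, 2π/3, 4π/3} let E(t) := (1 + sgn Q(t))/2, an orthogonal projection on L²(ℝ). Then sup over unit vectors ψ ∈ L²(ℝ) of (1/3)⟨ψ, (E(0) + E(2π/3) + E(4π/3))ψ⟩ is strictly less than 1. -/
open MeasureTheory Complex Real
open scoped InnerProductSpace ComplexConjugate

noncomputable section

/-- The complex Hilbert space `L²(ℝ, ℂ)`. -/
abbrev L2 : Type := Lp ℂ 2 (volume : Measure ℝ)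

/-- `F` is the Fourier–Plancherel unitary operator on `L²(ℝ)`,
with convention `(Fψ)(p) = (2π)^{-1/2} ∫ e^{-ipq} ψ(q) dq`
(this property on the dense subspace `L¹ ∩ L²` determines `F` uniquely). -/
def IsFourier (F : L2 ≃ₗᵢ[ℂ] L2) : Prop :=
  ∀ ψ : L2, Integrable (⇑ψ) volume →
    (F ψ : ℝ → ℂ) =ᵐ[volume]
      fun p : ℝ => (((2 * π) ^ (-(1:ℝ)/2) : ℝ) : ℂ) *
        ∫ q : ℝ, Complex.exp (-(Complex.I) * (p : ℂ) * (q : ℂ)) * ψ q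

/-- `T` is the bounded multiplication operator `M_g` by `g` on `L²(ℝ)`. -/
def IsMulOp (g : ℝ → ℂ) (T : L2 →L[ℂ] L2) : Prop :=
  ∀ ψ : L2, (T ψ : ℝ → ℂ) =ᵐ[volume] fun q => g q * ψ q

/-- `T = sgn P := 𝓕⁻¹ ∘ M_sgn ∘ 𝓕`. -/
def IsSgnP (T : L2 →L[ℂ] L2) : Prop :=
  ∃ F : L2 ≃ₗᵢ[ℂ] L2, IsFourier F ∧
    ∀ ψ : L2, (F (T ψ) : ℝ → ℂ) =ᵐ[volume]
      fun p => ((Real.sign p : ℝ) : ℂ) * (F ψ : ℝ → ℂ) p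

/-- `χ_t(q) = exp(−(i/2)(cot t) q²)`. -/
def chi (t q : ℝ) : ℂ :=
  Complex.exp (-(Complex.I / 2) * ((Real.cos t / Real.sin t : ℝ) : ℂ) * (q : ℂ) ^ 2)

/-- `T = sgn Q(t)`: for `t = 0` this is `M_sgn`, and for `sin t ≠ 0` it is
`sgn(sin t) · M_{χ_t} ∘ (sgn P) ∘ M_{χ_t}⁻¹`, which realizes `sgn(Q cos t + P sin t)`. -/
def IsSgnQ (t : ℝ) (T : L2 →L[ℂ] L2) : Prop :=
  if t = 0 then IsMulOp (fun q => ((Real.sign q : ℝ) : ℂ)) T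
  else ∃ P Mc Mci : L2 →L[ℂ] L2, IsSgnP P ∧ IsMulOp (chi t) Mc ∧
    IsMulOp (fun q => (chi t q)⁻¹) Mci ∧
    T = (((Real.sign (Real.sin t) : ℝ) : ℂ) • (Mc ∘L P ∘L Mci))

/-- The Gaussian wave packet of complex width parameter `b` centred at the phase space point
`(x, p)`. -/
def gaussWave (b : ℂ) (x p q : ℝ) : ℂ :=
  Complex.exp (-b * ((q : ℂ) - x) ^ 2) * Complex.exp (Complex.I * p * q)

/-- The short-time Fourier transform of `u` with window `s ↦ exp (-b s²)`. -/
def gabor (b : ℂ) (u : ℝ → ℂ) (x p : ℝ) : ℂ :=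
  (((2 * π) ^ (-(1:ℝ)/2) : ℝ) : ℂ) *
    ∫ q : ℝ, Complex.exp (-(Complex.I) * (p : ℂ) * (q : ℂ)) *
      (Complex.exp (-b * ((q : ℂ) - x) ^ 2) * u q)

theorem enorm_sq_eq_lintegral (f : L2) : ‖f‖ₑ ^ 2 = ∫⁻ q, ‖f q‖ₑ ^ 2 := by
  have h := eLpNorm_nnreal_pow_eq_lintegral (f := f) (μ := (volume : Measure ℝ))
    (p := 2) (by norm_num)
  rw [Lp.enorm_def]
  simpa using h

theorem norm_cexp_I_mul_mul (p q : ℝ) : ‖Complex.exp (Complex.I * p * q)‖ = 1 := by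
  rw [mul_assoc, ← Complex.ofReal_mul, mul_comm, Complex.norm_exp_ofReal_mul_I]

theorem norm_gaussWave (b : ℂ) (x p q : ℝ) :
    ‖gaussWave b x p q‖ = Real.exp (-b.re * (q - x) ^ 2) := by
  rw [gaussWave, norm_mul, norm_cexp_I_mul_mul, mul_one, ← Complex.ofReal_sub,
    norm_cexp_neg_mul_sq]

theorem continuous_gaussWave (b : ℂ) (x p : ℝ) : Continuous (gaussWave b x p) := by
  unfold gaussWave
  fun_prop

theorem memLp_gaussWave {b : ℂ} (hb : 0 < b.re) (x p : ℝ) :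
    MemLp (gaussWave b x p) 2 := by
  rw [memLp_two_iff_integrable_sq_norm (continuous_gaussWave b x p).aestronglyMeasurable]
  have h := (integrable_exp_neg_mul_sq (b := 2 * b.re) (by linarith)).comp_sub_right x
  refine h.congr (Filter.Eventually.of_forall fun q => ?_)
  simp only [norm_gaussWave, ← Real.exp_nat_mul]
  congr 1
  push_cast
  ring

theorem integrable_gaussWave {b : ℂ} (hb : 0 < b.re) (x p : ℝ) :
    Integrable (gaussWave b x p) := by
  have h := (integrable_exp_neg_mul_sq hb).comp_sub_right x
  refine h.mono' (continuous_gaussWave b x p).aestronglyMeasurable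
    (Filter.Eventually.of_forall fun q => ?_)
  rw [norm_gaussWave]

theorem conj_gaussWave (b : ℂ) (x p q : ℝ) :
    conj (gaussWave (conj b) x p q) =
      Complex.exp (-(Complex.I) * p * q) * Complex.exp (-b * ((q : ℂ) - x) ^ 2) := by
  rw [gaussWave, map_mul, ← Complex.exp_conj, ← Complex.exp_conj, mul_comm]
  simp

theorem gabor_eq_inner {b : ℂ} (hb : 0 < (conj b).re) (u : L2) (x p : ℝ) :
    gabor b u x p = (((2 * π) ^ (-(1:ℝ)/2) : ℝ) : ℂ) *
      ⟪(memLp_gaussWave hb x p).toLp, u⟫_ℂ := by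
  rw [gabor, L2.inner_def]
  congr 1
  refine integral_congr_ae ?_
  filter_upwards [(memLp_gaussWave hb x p).coeFn_toLp] with q hq
  rw [hq, RCLike.inner_apply, conj_gaussWave]
  ring

theorem enorm_gaussWave_toLp_sq {b : ℂ} (hb : 0 < b.re) (x p : ℝ) :
    ‖(memLp_gaussWave hb x p).toLp‖ₑ ^ 2 = ENNReal.ofReal √(π / (2 * b.re)) := by
  rw [enorm_sq_eq_lintegral]
  have h := (integrable_exp_neg_mul_sq (b := 2 * b.re) (by linarith)).comp_sub_right x
  rw [← integral_gaussian, ← integral_sub_right_eq_self _ x,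
    ofReal_integral_eq_lintegral_ofReal h (Filter.Eventually.of_forall fun q => by positivity)]
  refine lintegral_congr_ae ?_
  filter_upwards [(memLp_gaussWave hb x p).coeFn_toLp] with q hq
  rw [hq, ← ofReal_norm, ← ENNReal.ofReal_pow (norm_nonneg _), norm_gaussWave,
    ← Real.exp_nat_mul]
  congr 2
  push_cast
  ring

theorem enorm_two_pi_rpow_sq :
    ‖(((2 * π) ^ (-(1:ℝ)/2) : ℝ) : ℂ)‖ₑ ^ 2 = ENNReal.ofReal (1 / (2 * π)) := by
  have h : 0 < 2 * π := by positivity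
  rw [← ofReal_norm, ← ENNReal.ofReal_pow (norm_nonneg _), Complex.norm_real,
    Real.norm_eq_abs, sq_abs, ← Real.rpow_natCast, ← Real.rpow_mul h.le]
  norm_num [Real.rpow_neg_one]

theorem enorm_gabor_sq_le {b : ℂ} (hb : 0 < b.re) (u : L2) (x p : ℝ) :
    ‖gabor b u x p‖ₑ ^ 2 ≤
      ENNReal.ofReal (1 / (2 * π)) * (ENNReal.ofReal √(π / (2 * b.re)) * ‖u‖ₑ ^ 2) := by
  have hb' : 0 < (conj b).re := by simpa using hb
  have hi (v w : L2) : ‖⟪v, w⟫_ℂ‖ₑ ≤ ‖v‖ₑ * ‖w‖ₑ := by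
    rw [← ofReal_norm, ← ofReal_norm, ← ofReal_norm,
      ← ENNReal.ofReal_mul (norm_nonneg _)]
    exact ENNReal.ofReal_le_ofReal (norm_inner_le_norm v w)
  rw [gabor_eq_inner hb', enorm_mul, mul_pow, enorm_two_pi_rpow_sq]
  gcongr
  refine (pow_le_pow_left' (hi _ _) 2).trans ?_
  rw [mul_pow, enorm_gaussWave_toLp_sq hb', Complex.conj_re]

/-- Frequency marginal of the squared short-time Fourier transform. -/
theorem lintegral_enorm_gabor_sq {F : L2 ≃ₗᵢ[ℂ] L2} (hF : IsFourier F) {b : ℂ} (hb : 0 < b.re)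
    (u : L2) (x : ℝ) :
    ∫⁻ p, ‖gabor b u x p‖ₑ ^ 2 =
      ∫⁻ q, ENNReal.ofReal (Real.exp (-(2 * b.re) * (q - x) ^ 2)) * ‖u q‖ₑ ^ 2 := by
  have hb' : 0 < (conj b).re := by simpa using hb
  set w : ℝ → ℂ := fun q => Complex.exp (-b * ((q : ℂ) - x) ^ 2) * u q with hw
  have hg : ∀ q : ℝ, Complex.exp (-b * ((q : ℂ) - x) ^ 2) = gaussWave b x 0 q := by
    intro q; simp [gaussWave]
  have hmeas : AEStronglyMeasurable w := by
    refine AEStronglyMeasurable.mul ?_ (Lp.aestronglyMeasurable u)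
    exact Continuous.aestronglyMeasurable (by fun_prop)
  have hw1 : Integrable w := by
    have := (memLp_gaussWave hb x 0).integrable_mul (Lp.memLp u)
    refine this.congr (Filter.Eventually.of_forall fun q => ?_)
    rw [hw, Pi.mul_apply, ← hg]
  have hw2 : MemLp w 2 := by
    refine (Lp.memLp u).mono hmeas (Filter.Eventually.of_forall fun q => ?_)
    rw [hw]
    simp only [hg, norm_mul, norm_gaussWave]
    refine mul_le_of_le_one_left (norm_nonneg _) (Real.exp_le_one_iff.2 ?_)
    nlinarith [mul_nonneg hb.le (sq_nonneg (q - x))]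
  have hco := hw2.coeFn_toLp
  have hFw := hF hw2.toLp (hw1.congr hco.symm)
  have h1 : ∫⁻ p, ‖gabor b u x p‖ₑ ^ 2 = ‖F hw2.toLp‖ₑ ^ 2 := by
    rw [enorm_sq_eq_lintegral]
    refine lintegral_congr_ae ?_
    filter_upwards [hFw] with p hp
    rw [hp, gabor]
    congr 3
    refine integral_congr_ae ?_
    filter_upwards [hco] with q hq
    rw [hq]
  rw [h1, LinearIsometryEquiv.enorm_map, enorm_sq_eq_lintegral]
  refine lintegral_congr_ae ?_
  filter_upwards [hco] with q hq
  rw [hq, hw]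
  simp only [hg, enorm_mul, mul_pow]
  rw [← ofReal_norm (gaussWave b x 0 q), ← ENNReal.ofReal_pow (norm_nonneg _),
    norm_gaussWave, ← Real.exp_nat_mul]
  congr 3
  push_cast
  ring

theorem fourier_gaussWave {F : L2 ≃ₗᵢ[ℂ] L2} (hF : IsFourier F) {b : ℂ} (hb : 0 < b.re)
    (x p : ℝ) :
    (F (memLp_gaussWave hb x p).toLp : ℝ → ℂ) =ᵐ[volume] fun ξ : ℝ =>
      (((2 * π) ^ (-(1:ℝ)/2) : ℝ) : ℂ) * ((π / b) ^ (1 / 2 : ℂ) *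
        (Complex.exp (-(Complex.I) * (ξ - p) * x) *
          Complex.exp (-(4 * b)⁻¹ * ((ξ : ℂ) - p) ^ 2))) := by
  have hco := (memLp_gaussWave hb x p).coeFn_toLp
  filter_upwards [hF _ ((integrable_gaussWave hb x p).congr hco.symm)] with ξ hξ
  rw [hξ]
  congr 1
  have h1 : ∫ q : ℝ, Complex.exp (-(Complex.I) * (ξ : ℂ) * (q : ℂ)) *
        ((memLp_gaussWave hb x p).toLp : ℝ → ℂ) q =
      ∫ q : ℝ, Complex.exp (-(Complex.I) * (ξ - p) * x) *
        (Complex.exp (Complex.I * (-(ξ - p) : ℂ) * ((q - x : ℝ) : ℂ)) *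
          Complex.exp (-b * ((q - x : ℝ) : ℂ) ^ 2)) := by
    refine integral_congr_ae ?_
    filter_upwards [hco] with q hq
    rw [hq, gaussWave, ← Complex.exp_add, ← Complex.exp_add, ← Complex.exp_add, ← Complex.exp_add]
    congr 1
    push_cast
    ring
  rw [h1, integral_const_mul, integral_sub_right_eq_self (fun q : ℝ =>
    Complex.exp (Complex.I * (-(ξ - p) : ℂ) * (q : ℂ)) * Complex.exp (-b * (q : ℂ) ^ 2)) x,
    fourierIntegral_gaussian hb]
  have h2 : -(-((ξ : ℂ) - p)) ^ 2 / (4 * b) = -(4 * b)⁻¹ * ((ξ : ℂ) - p) ^ 2 := by ring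
  rw [h2]
  ring

/-- The Fourier transform rotates the phase plane by a right angle. -/
theorem gabor_eq_gabor_fourier {F : L2 ≃ₗᵢ[ℂ] L2} (hF : IsFourier F) {b : ℂ} (hb : 0 < b.re)
    (u : L2) (x p : ℝ) :
    gabor b u x p = (((2 * π) ^ (-(1:ℝ)/2) : ℝ) : ℂ) * conj ((π / conj b) ^ (1 / 2 : ℂ)) *
      Complex.exp (-(Complex.I) * p * x) * gabor (4 * b)⁻¹ (F u) p (-x) := by
  have hb' : 0 < (conj b).re := by simpa using hb
  rw [gabor_eq_inner hb', ← F.inner_map_map, L2.inner_def, gabor, mul_left_comm _ _ (integral _ _),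
    ← integral_const_mul, ← integral_const_mul, ← integral_const_mul]
  refine integral_congr_ae ?_
  filter_upwards [fourier_gaussWave hF hb' x p] with ξ hξ
  rw [hξ, RCLike.inner_apply]
  have e : Complex.exp (-(Complex.I) * p * x) * Complex.exp (-(Complex.I) * (-x : ℝ) * ξ) =
      conj (Complex.exp (-(Complex.I) * (ξ - p) * x)) := by
    rw [← Complex.exp_conj, ← Complex.exp_add]
    congr 1
    simp
    ring
  have e' : Complex.exp (-(4 * b)⁻¹ * ((ξ : ℂ) - p) ^ 2) =
      conj (Complex.exp (-(4 * conj b)⁻¹ * ((ξ : ℂ) - p) ^ 2)) := by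
    rw [← Complex.exp_conj]
    simp [Complex.conj_ofNat]
  simp only [map_mul]
  rw [← e, ← e', Complex.conj_ofReal]
  ring

theorem enorm_cpow_half_sq (z : ℂ) : ‖conj (z ^ (1 / 2 : ℂ))‖ₑ ^ 2 = ‖z‖ₑ := by
  rw [← ofReal_norm, RCLike.norm_conj, ofReal_norm, ← enorm_pow, ← Complex.cpow_nat_mul]
  norm_num

theorem enorm_gabor_sq_eq_fourier {F : L2 ≃ₗᵢ[ℂ] L2} (hF : IsFourier F) {b : ℂ} (hb : 0 < b.re)
    (u : L2) (x p : ℝ) :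
    ‖gabor b u x p‖ₑ ^ 2 =
      ENNReal.ofReal (1 / (2 * ‖b‖)) * ‖gabor (4 * b)⁻¹ (F u) p (-x)‖ₑ ^ 2 := by
  have hb0 : 0 < ‖b‖ := norm_pos_iff.2 fun h => by simp [h] at hb
  have hexp : ‖Complex.exp (-(Complex.I) * p * x)‖ₑ = 1 := by
    have := norm_cexp_I_mul_mul (-p) x
    rw [← ofReal_norm, ← ENNReal.ofReal_one, ← this]
    simp
  rw [gabor_eq_gabor_fourier hF hb]
  simp only [enorm_mul, mul_pow]
  rw [enorm_two_pi_rpow_sq, enorm_cpow_half_sq, hexp, one_pow, mul_one, ← ofReal_norm (_ / _),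
    ← ENNReal.ofReal_mul (by positivity)]
  congr 2
  rw [norm_div, RCLike.norm_conj, Complex.norm_real, Real.norm_eq_abs, abs_of_pos Real.pi_pos]
  field_simp

/-- Position marginal of the squared short-time Fourier transform. -/
theorem lintegral_enorm_gabor_sq_fst {F : L2 ≃ₗᵢ[ℂ] L2} (hF : IsFourier F) {b : ℂ}
    (hb : 0 < b.re) (u : L2) (p : ℝ) :
    ∫⁻ x, ‖gabor b u x p‖ₑ ^ 2 = ENNReal.ofReal (1 / (2 * ‖b‖)) *
      ∫⁻ ξ, ENNReal.ofReal (Real.exp (-(2 * (4 * b)⁻¹.re) * (ξ - p) ^ 2)) * ‖F u ξ‖ₑ ^ 2 := by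
  have hb' : 0 < ((4 * b)⁻¹).re := by
    rw [Complex.inv_re]
    refine div_pos (by simpa using hb) (Complex.normSq_pos.2 fun h => ?_)
    have : b = 0 := by simpa using h
    simp [this] at hb
  rw [← lintegral_enorm_gabor_sq hF hb', ← lintegral_const_mul' _ _ ENNReal.ofReal_ne_top,
    ← lintegral_sub_left_eq_self _ 0]
  refine lintegral_congr fun x => ?_
  rw [enorm_gabor_sq_eq_fourier hF hb]
  simp

/-- Multiplication by a chirp shears the phase plane. -/
theorem enorm_gabor_shear (b : ℂ) (c : ℝ) {u v : ℝ → ℂ}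
    (huv : v =ᵐ[volume] fun q : ℝ => Complex.exp (-(Complex.I * c / 2) * (q : ℂ) ^ 2) * u q)
    (x p : ℝ) :
    ‖gabor b u x (c * x + p)‖ₑ = ‖gabor (b - Complex.I * c / 2) v x p‖ₑ := by
  have h : gabor b u x (c * x + p) =
      Complex.exp (Complex.I * (-(c * x) / 2 : ℝ) * x) * gabor (b - Complex.I * c / 2) v x p := by
    rw [gabor, gabor, mul_left_comm]
    congr 1
    rw [← integral_const_mul]
    refine integral_congr_ae ?_
    filter_upwards [huv] with q hq
    rw [hq]
    simp only [← mul_assoc, ← Complex.exp_add]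
    congr 2
    push_cast
    ring
  rw [h, enorm_mul, ← ofReal_norm (Complex.exp _), norm_cexp_I_mul_mul, ENNReal.ofReal_one, one_mul]

theorem lintegral_enorm_gabor_shear_sq {F : L2 ≃ₗᵢ[ℂ] L2} (hF : IsFourier F) {a c : ℝ}
    (ha : 0 < a) (hac : a ^ 2 = 1 + c ^ 2) {u v : L2}
    (huv : v =ᵐ[volume] fun q : ℝ => Complex.exp (-(Complex.I * c / 2) * (q : ℂ) ^ 2) * u q)
    (p : ℝ) :
    ∫⁻ x, ‖gabor (1 / 2) u x (c * x + p)‖ₑ ^ 2 =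
      ∫⁻ ξ, ENNReal.ofReal (1 / a * Real.exp (-(ξ - p) ^ 2 / a ^ 2)) * ‖F v ξ‖ₑ ^ 2 := by
  have hre : (1 / 2 - Complex.I * c / 2 : ℂ).re = 1 / 2 := by simp
  have him : (1 / 2 - Complex.I * c / 2 : ℂ).im = -(c / 2) := by simp
  have hnorm : 2 * ‖(1 / 2 - Complex.I * c / 2 : ℂ)‖ = a := by
    rw [← sq_eq_sq₀ (by positivity) ha.le, mul_pow, Complex.sq_norm, Complex.normSq_apply, hre,
      him, hac]
    ring
  have hinv : 2 * ((4 * (1 / 2 - Complex.I * c / 2 : ℂ))⁻¹).re = 1 / a ^ 2 := by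
    have h4 : (4 * (1 / 2 - Complex.I * c / 2) : ℂ).re = 2 := by simp; norm_num
    have h5 : (4 * (1 / 2 - Complex.I * c / 2) : ℂ).im = -(2 * c) := by simp; ring
    rw [Complex.inv_re, Complex.normSq_apply, h4, h5, hac]
    have : 0 < 1 + c ^ 2 := by positivity
    field_simp
  simp only [enorm_gabor_shear _ c huv]
  rw [lintegral_enorm_gabor_sq_fst hF (by rw [hre]; norm_num), hnorm, hinv,
    ← lintegral_const_mul' _ _ ENNReal.ofReal_ne_top]
  refine lintegral_congr fun ξ => ?_
  rw [← mul_assoc, ← ENNReal.ofReal_mul (by positivity)]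
  congr 4
  ring

theorem measurable_enorm_gabor_sq (b : ℂ) (u : L2) :
    Measurable fun z : ℝ × ℝ => ‖gabor b u z.1 z.2‖ₑ ^ 2 := by
  have h : StronglyMeasurable fun z : ℝ × ℝ => ∫ q : ℝ,
      Complex.exp (-(Complex.I) * (z.2 : ℂ) * (q : ℂ)) *
      (Complex.exp (-b * ((q : ℂ) - z.1) ^ 2) * u q) := by
    refine StronglyMeasurable.integral_prod_right ?_
    have hu : StronglyMeasurable fun w : (ℝ × ℝ) × ℝ => u w.2 :=
      (Lp.stronglyMeasurable u).comp_measurable measurable_snd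
    refine StronglyMeasurable.mul ?_ (StronglyMeasurable.mul ?_ hu)
    · exact Continuous.stronglyMeasurable (by fun_prop)
    · exact Continuous.stronglyMeasurable (by fun_prop)
  exact ((h.const_mul _).measurable.enorm).pow_const 2

theorem integrable_gaussianKernel {a : ℝ} (ha : 0 < a) :
    Integrable fun s : ℝ => 1 / a * Real.exp (-s ^ 2 / a ^ 2) := by
  refine ((integrable_exp_neg_mul_sq (b := 1 / a ^ 2) (by positivity)).const_mul (1 / a)).congr
    (Filter.Eventually.of_forall fun s => ?_)
  simp only
  congr 2
  ring

theorem integral_gaussianKernel {a : ℝ} (ha : 0 < a) :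
    ∫ s : ℝ, 1 / a * Real.exp (-s ^ 2 / a ^ 2) = √π := by
  have h : ∀ s : ℝ, -s ^ 2 / a ^ 2 = -(1 / a ^ 2) * s ^ 2 := fun s => by ring
  simp only [h]
  rw [integral_const_mul, integral_gaussian, div_div_eq_mul_div, div_one,
    Real.sqrt_mul Real.pi_pos.le, Real.sqrt_sq ha.le]
  field_simp

theorem integral_Ioi_gaussianKernel_le {a L : ℝ} (ha : 0 < a) (hL : 0 ≤ L) :
    ∫ s in Set.Ioi (a * L), 1 / a * Real.exp (-s ^ 2 / a ^ 2) ≤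
      (√π - 2 * (L - L ^ 3 / 3)) / 2 := by
  have hi := integrable_gaussianKernel ha
  have haL : -(a * L) ≤ a * L := by nlinarith [mul_nonneg ha.le hL]
  have hsplit := intervalIntegral.integral_Iic_add_Ioi (b := -(a * L)) hi.integrableOn hi.integrableOn
  have hsplit' := intervalIntegral.integral_interval_add_Ioi (a := -(a * L)) (b := a * L)
    hi.integrableOn hi.integrableOn
  have hneg : ∫ s in Set.Iic (-(a * L)), 1 / a * Real.exp (-s ^ 2 / a ^ 2) =
      ∫ s in Set.Ioi (a * L), 1 / a * Real.exp (-s ^ 2 / a ^ 2) := by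
    rw [← integral_comp_neg_Ioi]
    simp
  have hmid : 2 * (L - L ^ 3 / 3) ≤
      ∫ s in (-(a * L))..(a * L), 1 / a * Real.exp (-s ^ 2 / a ^ 2) := by
    have h1 : ∫ s in (-(a * L))..(a * L), (1 / a - 1 / a ^ 3 * s ^ 2) = 2 * (L - L ^ 3 / 3) := by
      rw [intervalIntegral.integral_sub (by simp)
        (Continuous.intervalIntegrable (by fun_prop) _ _)]
      simp only [intervalIntegral.integral_const_mul, intervalIntegral.integral_const,
        integral_pow, smul_eq_mul]
      field_simp
      ring
    rw [← h1]
    refine intervalIntegral.integral_mono_on haL (Continuous.intervalIntegrable (by fun_prop) _ _)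
      hi.intervalIntegrable fun s _ => ?_
    have h2 : 1 / a - 1 / a ^ 3 * s ^ 2 = 1 / a * (-s ^ 2 / a ^ 2 + 1) := by
      field_simp
      ring
    rw [h2]
    exact mul_le_mul_of_nonneg_left (Real.add_one_le_exp _) (by positivity)
  rw [integral_gaussianKernel ha] at hsplit
  linarith

theorem setLIntegral_gaussianKernel_le {a L : ℝ} (ha : 0 < a) (hL : 0 ≤ L) (y : ℝ) :
    ∫⁻ p in Set.Ioi (a * L), ENNReal.ofReal (1 / a * Real.exp (-(y - p) ^ 2 / a ^ 2)) ≤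
      (Set.Ioi 0).indicator (fun _ => ENNReal.ofReal √π) y +
        ENNReal.ofReal ((√π - 2 * (L - L ^ 3 / 3)) / 2) := by
  have hi := integrable_gaussianKernel ha
  have hnn : ∀ s : ℝ, 0 ≤ 1 / a * Real.exp (-s ^ 2 / a ^ 2) := fun s => by positivity
  by_cases hy : 0 < y
  · rw [Set.indicator_of_mem (Set.mem_Ioi.2 hy)]
    refine le_add_right ((setLIntegral_le_lintegral _ _).trans_eq ?_)
    rw [lintegral_sub_left_eq_self
      (fun s : ℝ => ENNReal.ofReal (1 / a * Real.exp (-s ^ 2 / a ^ 2))) y,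
      ← integral_gaussianKernel ha,
      ofReal_integral_eq_lintegral_ofReal hi (Filter.Eventually.of_forall hnn)]
  · refine le_add_left ?_
    refine le_trans ?_ (ENNReal.ofReal_le_ofReal (integral_Ioi_gaussianKernel_le ha hL))
    rw [ofReal_integral_eq_lintegral_ofReal hi.integrableOn (Filter.Eventually.of_forall hnn)]
    refine setLIntegral_mono' measurableSet_Ioi fun p hp => ?_
    have hp' : 0 < p := (mul_nonneg ha.le hL).trans_lt hp
    refine ENNReal.ofReal_le_ofReal (mul_le_mul_of_nonneg_left (Real.exp_le_exp.2
      (div_le_div_of_nonneg_right ?_ (by positivity))) (by positivity))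
    nlinarith

theorem setLIntegral_gaussianKernel_le' {a L : ℝ} (ha : 0 < a) (hL : 0 ≤ L) (y : ℝ) :
    ∫⁻ p in Set.Iio (-(a * L)), ENNReal.ofReal (1 / a * Real.exp (-(y - p) ^ 2 / a ^ 2)) ≤
      (Set.Iio 0).indicator (fun _ => ENNReal.ofReal √π) y +
        ENNReal.ofReal ((√π - 2 * (L - L ^ 3 / 3)) / 2) := by
  have h := setLIntegral_gaussianKernel_le ha hL (-y)
  have e : (Set.Ioi (0 : ℝ)).indicator (fun _ => ENNReal.ofReal √π) (-y) =
      (Set.Iio (0 : ℝ)).indicator (fun _ => ENNReal.ofReal √π) y := by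
    simp [Set.indicator_apply]
  rw [e] at h
  refine le_trans (le_of_eq ?_) h
  rw [← lintegral_indicator measurableSet_Iio, ← lintegral_indicator measurableSet_Ioi,
    ← lintegral_sub_left_eq_self _ 0]
  refine lintegral_congr fun p => ?_
  simp only [Set.indicator_apply, Set.mem_Iio, Set.mem_Ioi, zero_sub, neg_lt_neg_iff]
  have : (y - -p) ^ 2 = (-y - p) ^ 2 := by ring
  rw [this]

/-- If the kernel mass that a half line `S` receives from `y` is at most `√π` on `T` plus a tail
`δ`, then the smoothed density gives `S` at most `√π` times the mass of `T` plus `δ`. -/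
theorem setLIntegral_smoothing_le {S T : Set ℝ} (hT : MeasurableSet T) {a : ℝ} {δ : ENNReal}
    (h : ∀ y, ∫⁻ p in S, ENNReal.ofReal (1 / a * Real.exp (-(y - p) ^ 2 / a ^ 2)) ≤
      T.indicator (fun _ => ENNReal.ofReal √π) y + δ)
    (v : L2) (hv : ‖v‖ = 1) :
    ∫⁻ p in S, ∫⁻ y, ENNReal.ofReal (1 / a * Real.exp (-(y - p) ^ 2 / a ^ 2)) * ‖v y‖ₑ ^ 2 ≤
      ENNReal.ofReal √π * (∫⁻ y in T, ‖v y‖ₑ ^ 2) + δ := by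
  have hvm : Measurable fun y => ‖v y‖ₑ ^ 2 :=
    (Lp.stronglyMeasurable v).measurable.enorm.pow_const 2
  have hv1 : ∫⁻ y, ‖v y‖ₑ ^ 2 = 1 := by
    rw [← enorm_sq_eq_lintegral, ← ofReal_norm, hv]
    simp
  rw [lintegral_lintegral_swap (by fun_prop)]
  calc _ ≤ ∫⁻ y, (ENNReal.ofReal √π * T.indicator (fun y => ‖v y‖ₑ ^ 2) y + δ * ‖v y‖ₑ ^ 2) := by
        refine lintegral_mono fun y => ?_
        rw [lintegral_mul_const _ (by fun_prop)]
        refine (mul_le_mul_left (h y) _).trans_eq ?_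
        rw [add_mul]
        by_cases hy : y ∈ T <;> simp [hy]
    _ = _ := by
        rw [lintegral_add_left (by exact measurable_const.mul (hvm.indicator hT)),
          lintegral_const_mul _ (hvm.indicator hT), lintegral_const_mul _ hvm, hv1, mul_one,
          lintegral_indicator hT]

theorem re_inner_add_two_mul_le {T : Set ℝ} (hT : MeasurableSet T) {g : ℝ → ℝ}
    (hg : ∀ y, g y ≤ 1) (hgT : ∀ y ∈ T, g y = -1) {v w : L2}
    (hw : w =ᵐ[volume] fun y => (g y : ℂ) * v y) :
    (⟪v, w⟫_ℂ).re + 2 * (∫⁻ y in T, ‖v y‖ₑ ^ 2).toReal ≤ ‖v‖ ^ 2 := by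
  have hsq : Integrable fun y => ‖v y‖ ^ 2 :=
    (memLp_two_iff_integrable_sq_norm (Lp.aestronglyMeasurable v)).1 (Lp.memLp v)
  have hvw : Integrable fun y => ⟪v y, w y⟫_ℂ := L2.integrable_inner v w
  have hpt : (fun y => (⟪v y, w y⟫_ℂ).re) =ᵐ[volume] fun y => g y * ‖v y‖ ^ 2 := by
    filter_upwards [hw] with y hy
    rw [hy, RCLike.inner_apply, mul_assoc, Complex.mul_conj, Complex.normSq_eq_norm_sq,
      ← Complex.ofReal_mul, Complex.ofReal_re]
  have h1 : (⟪v, w⟫_ℂ).re = ∫ y, g y * ‖v y‖ ^ 2 := by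
    rw [L2.inner_def]
    exact (integral_re hvw).symm.trans (integral_congr_ae hpt)
  have hgi : Integrable fun y => g y * ‖v y‖ ^ 2 := hvw.re.congr hpt
  have h2 : (∫⁻ y in T, ‖v y‖ₑ ^ 2).toReal = ∫ y, T.indicator (fun y => ‖v y‖ ^ 2) y := by
    rw [integral_indicator hT, integral_eq_lintegral_of_nonneg_ae
      (Filter.Eventually.of_forall fun y => by positivity) hsq.1.restrict]
    congr 1
    refine lintegral_congr fun y => ?_
    rw [ENNReal.ofReal_pow (norm_nonneg _), ofReal_norm]
  have h3 : ‖v‖ ^ 2 = ∫ y, ‖v y‖ ^ 2 := by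
    rw [← inner_self_eq_norm_sq (𝕜 := ℂ), L2.inner_def, ← integral_re (L2.integrable_inner v v)]
    simp [← Complex.ofReal_pow]
  rw [h1, h2, h3, ← integral_const_mul,
    ← integral_add hgi ((hsq.indicator hT).const_mul 2)]
  refine integral_mono (hgi.add ((hsq.indicator hT).const_mul 2)) hsq fun y => ?_
  by_cases hy : y ∈ T
  · simp only [Set.indicator_of_mem hy, hgT y hy]
    linarith
  · simp only [Set.indicator_of_notMem hy]
    nlinarith [mul_nonneg (sub_nonneg.2 (hg y)) (sq_nonneg ‖v y‖)]

/-- The phase space region lying between three half planes is a triangle of area `4 c`. -/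
theorem lintegral_triangle {c : ℝ} (hc : 0 ≤ c) (M : ENNReal) :
    ∫⁻ x : ℝ, ∫⁻ p : ℝ, (Set.Icc (-(2 / 3)) (4 / 3)).indicator
        (fun x => (Set.Icc (c * x - 4 / 3 * c) (4 / 3 * c - c * x)).indicator (fun _ => M) p) x =
      M * ENNReal.ofReal (4 * c) := by
  have h1 : ∀ x : ℝ, ∫⁻ p : ℝ, (Set.Icc (-(2 / 3)) (4 / 3)).indicator
        (fun x => (Set.Icc (c * x - 4 / 3 * c) (4 / 3 * c - c * x)).indicator (fun _ => M) p) x =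
      (Set.Icc (-(2 / 3)) (4 / 3)).indicator
        (fun x => M * ENNReal.ofReal (2 * c * (4 / 3 - x))) x := by
    intro x
    by_cases hx : x ∈ Set.Icc (-(2 / 3) : ℝ) (4 / 3)
    · simp only [Set.indicator_of_mem hx]
      rw [lintegral_indicator measurableSet_Icc, setLIntegral_const, Real.volume_Icc]
      congr 2
      ring
    · simp [Set.indicator_of_notMem hx]
  have hcont : Continuous fun x : ℝ => 2 * c * (4 / 3 - x) := by fun_prop
  simp only [h1]
  rw [lintegral_indicator measurableSet_Icc, lintegral_const_mul _ (by fun_prop),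
    ← ofReal_integral_eq_lintegral_ofReal (hcont.integrableOn_Icc),
    integral_Icc_eq_integral_Ioc, ← intervalIntegral.integral_of_le (by norm_num)]
  · congr 2
    rw [intervalIntegral.integral_const_mul, intervalIntegral.integral_sub (by simp) (by simp)]
    simp only [intervalIntegral.integral_const, integral_id, smul_eq_mul]
    ring
  · filter_upwards [ae_restrict_mem measurableSet_Icc] with x hx
    exact mul_nonneg (by positivity) (sub_nonneg.2 hx.2)

theorem lintegral_sheared_halfPlane_le {F : L2 ≃ₗᵢ[ℂ] L2} (hF : IsFourier F) {a c : ℝ}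
    (ha : 0 < a) (hac : a ^ 2 = 1 + c ^ 2) {u v : L2} (hv : ‖v‖ = 1)
    (huv : v =ᵐ[volume] fun q : ℝ => Complex.exp (-(Complex.I * c / 2) * (q : ℂ) ^ 2) * u q)
    {S T : Set ℝ} (hS : MeasurableSet S) (hT : MeasurableSet T) {δ : ENNReal}
    (h : ∀ y, ∫⁻ p in S, ENNReal.ofReal (1 / a * Real.exp (-(y - p) ^ 2 / a ^ 2)) ≤
      T.indicator (fun _ => ENNReal.ofReal √π) y + δ) :
    ∫⁻ x : ℝ, ∫⁻ p : ℝ, S.indicator (fun _ => ‖gabor (1 / 2) u x p‖ₑ ^ 2) (p - c * x) ≤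
      ENNReal.ofReal √π * (∫⁻ y in T, ‖F v y‖ₑ ^ 2) + δ := by
  refine le_trans (le_of_eq ?_)
    (setLIntegral_smoothing_le hT h (F v) (by rw [LinearIsometryEquiv.norm_map, hv]))
  have hm : Measurable fun z : ℝ × ℝ => ‖gabor (1 / 2) u z.1 (c * z.1 + z.2)‖ₑ ^ 2 :=
    (measurable_enorm_gabor_sq (1 / 2) u).comp
      (g := fun z : ℝ × ℝ => ‖gabor (1 / 2) u z.1 z.2‖ₑ ^ 2)
      (f := fun z : ℝ × ℝ => (z.1, c * z.1 + z.2)) (by fun_prop)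
  calc _ = ∫⁻ x : ℝ, ∫⁻ p in S, ‖gabor (1 / 2) u x (c * x + p)‖ₑ ^ 2 := by
        refine lintegral_congr fun x => ?_
        rw [← lintegral_indicator hS, ← lintegral_add_left_eq_self _ (c * x)]
        refine lintegral_congr fun p => ?_
        by_cases hp : p ∈ S <;> simp [hp]
    _ = ∫⁻ p in S, ∫⁻ x : ℝ, ‖gabor (1 / 2) u x (c * x + p)‖ₑ ^ 2 :=
        lintegral_lintegral_swap hm.aemeasurable
    _ = _ := lintegral_congr fun p => lintegral_enorm_gabor_shear_sq hF ha hac huv p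

theorem lintegral_halfPlane_le {F : L2 ≃ₗᵢ[ℂ] L2} (hF : IsFourier F) {u : L2} (hu : ‖u‖ = 1)
    {S T : Set ℝ} (hS : MeasurableSet S) (hT : MeasurableSet T) {δ : ENNReal}
    (h : ∀ y, ∫⁻ p in S, ENNReal.ofReal (1 / 1 * Real.exp (-(y - p) ^ 2 / 1 ^ 2)) ≤
      T.indicator (fun _ => ENNReal.ofReal √π) y + δ) :
    ∫⁻ x : ℝ, ∫⁻ p : ℝ, S.indicator (fun _ => ‖gabor (1 / 2) u x p‖ₑ ^ 2) x ≤
      ENNReal.ofReal √π * (∫⁻ y in T, ‖u y‖ₑ ^ 2) + δ := by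
  refine le_trans (le_of_eq ?_) (setLIntegral_smoothing_le hT h u hu)
  rw [← lintegral_indicator hS]
  refine lintegral_congr fun x => ?_
  by_cases hx : x ∈ S
  · simp only [Set.indicator_of_mem hx]
    rw [lintegral_enorm_gabor_sq hF (by norm_num)]
    norm_num
  · simp [Set.indicator_of_notMem hx]

theorem lintegral_enorm_gabor_sq_eq {F : L2 ≃ₗᵢ[ℂ] L2} (hF : IsFourier F) {u : L2}
    (hu : ‖u‖ = 1) :
    ∫⁻ x : ℝ, ∫⁻ p : ℝ, ‖gabor (1 / 2) u x p‖ₑ ^ 2 = ENNReal.ofReal √π := by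
  have hum : Measurable fun y => ‖u y‖ₑ ^ 2 :=
    (Lp.stronglyMeasurable u).measurable.enorm.pow_const 2
  simp only [lintegral_enorm_gabor_sq hF (b := 1 / 2) (by norm_num) u]
  rw [lintegral_lintegral_swap (by fun_prop)]
  have h (y : ℝ) : ∫⁻ x : ℝ, ENNReal.ofReal (Real.exp (-(2 * (1 / 2 : ℂ).re) * (y - x) ^ 2)) *
      ‖u y‖ₑ ^ 2 = ENNReal.ofReal √π * ‖u y‖ₑ ^ 2 := by
    rw [lintegral_mul_const _ (by fun_prop), lintegral_sub_left_eq_self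
      (fun s : ℝ => ENNReal.ofReal (Real.exp (-(2 * (1 / 2 : ℂ).re) * s ^ 2))) y,
      ← ofReal_integral_eq_lintegral_ofReal (integrable_exp_neg_mul_sq (by norm_num))
        (Filter.Eventually.of_forall fun s => by positivity), integral_gaussian]
    norm_num
  simp only [h]
  rw [lintegral_const_mul _ hum, ← enorm_sq_eq_lintegral, ← ofReal_norm, hu]
  simp

/-- The three half planes `x < 0`, `p < c x`, `-c x < p` cover the phase plane, so a state cannot
have small probability in each of them. -/
theorem sqrt_pi_le_of_three_halfPlanes {F G H : L2 ≃ₗᵢ[ℂ] L2} (hF : IsFourier F)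
    (hG : IsFourier G) (hH : IsFourier H)
    {c : ℝ} (hc : 0 < c) (hc3 : c ^ 2 = 1 / 3) {u v w : L2} (hu : ‖u‖ = 1) (hv : ‖v‖ = 1)
    (hw : ‖w‖ = 1)
    (huv : v =ᵐ[volume] fun q : ℝ => Complex.exp (-(Complex.I * c / 2) * (q : ℂ) ^ 2) * u q)
    (huw : w =ᵐ[volume] fun q : ℝ =>
      Complex.exp (-(Complex.I * (-c : ℝ) / 2) * (q : ℂ) ^ 2) * u q) :
    √π ≤ √π * ((∫⁻ y in Set.Iio 0, ‖u y‖ₑ ^ 2).toReal + (∫⁻ y in Set.Iio 0, ‖G v y‖ₑ ^ 2).toReal +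
      (∫⁻ y in Set.Ioi 0, ‖H w y‖ₑ ^ 2).toReal) +
      (3 * ((√π - 2 * (2 / 3 - (2 / 3) ^ 3 / 3)) / 2) + 2 * √π * c / π) := by
  set δ : ℝ := (√π - 2 * (2 / 3 - (2 / 3) ^ 3 / 3)) / 2 with hδ
  set D : ℝ → ℝ → ENNReal := fun x p => ‖gabor (1 / 2) u x p‖ₑ ^ 2 with hD
  set M : ENNReal := ENNReal.ofReal (√π / (2 * π)) with hM
  have hDm : Measurable fun z : ℝ × ℝ => D z.1 z.2 := measurable_enorm_gabor_sq (1 / 2) u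
  have hDM (x p : ℝ) : D x p ≤ M := by
    refine (enorm_gabor_sq_le (by norm_num) u x p).trans_eq ?_
    rw [← ofReal_norm, hu, ENNReal.ofReal_one, one_pow, mul_one,
      ← ENNReal.ofReal_mul (by positivity), hM]
    congr 1
    norm_num
    ring
  have h2c : (0 : ℝ) < 2 * c := by positivity
  have h2c' : (2 * c) ^ 2 = 1 + c ^ 2 := by rw [mul_pow, hc3]; norm_num
  have h2c'' : (2 * c) ^ 2 = 1 + (-c) ^ 2 := by rw [neg_sq, h2c']
  have b0 := lintegral_halfPlane_le hF hu measurableSet_Iio measurableSet_Iio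
    (setLIntegral_gaussianKernel_le' one_pos (by norm_num : (0 : ℝ) ≤ 2 / 3))
  have b2 := lintegral_sheared_halfPlane_le hG h2c h2c' hv huv measurableSet_Iio measurableSet_Iio
    (setLIntegral_gaussianKernel_le' h2c (by norm_num : (0 : ℝ) ≤ 2 / 3))
  have b4 := lintegral_sheared_halfPlane_le hH h2c h2c'' hw huw measurableSet_Ioi measurableSet_Ioi
    (setLIntegral_gaussianKernel_le h2c (by norm_num : (0 : ℝ) ≤ 2 / 3))
  have bt := lintegral_triangle hc.le M
  rw [← hδ] at b0 b2 b4
  have hcover (x p : ℝ) : D x p ≤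
      (Set.Iio (-(1 * (2 / 3)))).indicator (fun _ => D x p) x +
      ((Set.Iio (-(2 * c * (2 / 3)))).indicator (fun _ => D x p) (p - c * x) +
      ((Set.Ioi (2 * c * (2 / 3))).indicator (fun _ => D x p) (p - -c * x) +
      (Set.Icc (-(2 / 3)) (4 / 3)).indicator
        (fun x => (Set.Icc (c * x - 4 / 3 * c) (4 / 3 * c - c * x)).indicator
          (fun _ => M) p) x)) := by
    by_cases h0 : x < -(1 * (2 / 3))
    · rw [Set.indicator_of_mem (Set.mem_Iio.2 h0)]
      exact le_self_add
    refine le_add_left ?_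
    by_cases h2 : p - c * x < -(2 * c * (2 / 3))
    · rw [Set.indicator_of_mem (Set.mem_Iio.2 h2)]
      exact le_self_add
    refine le_add_left ?_
    by_cases h4 : 2 * c * (2 / 3) < p - -c * x
    · rw [Set.indicator_of_mem (Set.mem_Ioi.2 h4)]
      exact le_self_add
    refine le_add_left ?_
    push Not at h0 h2 h4
    have hx : x ≤ 4 / 3 := by
      by_contra hx
      push Not at hx
      nlinarith [mul_lt_mul_of_pos_left hx hc]
    have hx' : x ∈ Set.Icc (-(2 / 3) : ℝ) (4 / 3) := ⟨by linarith, hx⟩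
    have hp' : p ∈ Set.Icc (c * x - 4 / 3 * c) (4 / 3 * c - c * x) := ⟨by linarith, by linarith⟩
    rw [Set.indicator_of_mem hx', Set.indicator_of_mem hp']
    exact hDM x p
  have hm0 : Measurable fun z : ℝ × ℝ =>
      (Set.Iio (-(1 * (2 / 3)) : ℝ)).indicator (fun _ => D z.1 z.2) z.1 :=
    hDm.indicator (measurable_fst measurableSet_Iio)
  have hm2 : Measurable fun z : ℝ × ℝ =>
      (Set.Iio (-(2 * c * (2 / 3)))).indicator (fun _ => D z.1 z.2) (z.2 - c * z.1) :=
    hDm.indicator ((by fun_prop : Measurable fun z : ℝ × ℝ => z.2 - c * z.1) measurableSet_Iio)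
  have hm4 : Measurable fun z : ℝ × ℝ =>
      (Set.Ioi (2 * c * (2 / 3))).indicator (fun _ => D z.1 z.2) (z.2 - -c * z.1) :=
    hDm.indicator ((by fun_prop : Measurable fun z : ℝ × ℝ => z.2 - -c * z.1) measurableSet_Ioi)
  have hadd (f g : ℝ → ℝ → ENNReal) (hf : Measurable fun z : ℝ × ℝ => f z.1 z.2) :
      ∫⁻ x, ∫⁻ p, (f x p + g x p) = (∫⁻ x, ∫⁻ p, f x p) + ∫⁻ x, ∫⁻ p, g x p := by
    rw [← lintegral_add_left (Measurable.lintegral_prod_right' hf)]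
    exact lintegral_congr fun x => lintegral_add_left (hf.comp measurable_prodMk_left) _
  have key := lintegral_mono (μ := volume) fun x => lintegral_mono (μ := volume) fun p => hcover x p
  rw [lintegral_enorm_gabor_sq_eq hF hu, hadd _ _ hm0, hadd _ _ hm2, hadd _ _ hm4, bt] at key
  replace key := key.trans (add_le_add b0 (add_le_add b2 (add_le_add_left b4 _)))
  have hfin {z : L2} (hz : ‖z‖ = 1) (T : Set ℝ) : ∫⁻ y in T, ‖z y‖ₑ ^ 2 ≠ ⊤ := by
    refine ne_top_of_le_ne_top ENNReal.one_ne_top ((setLIntegral_le_lintegral _ _).trans_eq ?_)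
    rw [← enorm_sq_eq_lintegral, ← ofReal_norm, hz]
    simp
  have hδ0 : 0 ≤ δ := by
    have : (5 / 4 : ℝ) ≤ √π := Real.le_sqrt_of_sq_le (by linarith [Real.pi_gt_three])
    rw [hδ]
    linarith
  rw [← ENNReal.ofReal_toReal (hfin hu (Set.Iio 0)),
    ← ENNReal.ofReal_toReal (hfin ((G.norm_map v).trans hv) (Set.Iio 0)),
    ← ENNReal.ofReal_toReal (hfin ((H.norm_map w).trans hw) (Set.Ioi 0)), hM,
    ← ENNReal.ofReal_mul (by positivity), ← ENNReal.ofReal_mul (by positivity),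
    ← ENNReal.ofReal_mul (by positivity), ← ENNReal.ofReal_mul (by positivity),
    ← ENNReal.ofReal_add (by positivity) hδ0, ← ENNReal.ofReal_add (by positivity) hδ0,
    ← ENNReal.ofReal_add (by positivity) hδ0, ← ENNReal.ofReal_add (by positivity) (by positivity),
    ← ENNReal.ofReal_add (by positivity) (by positivity),
    ← ENNReal.ofReal_add (by positivity) (by positivity),
    ENNReal.ofReal_le_ofReal_iff (by positivity)] at key
  refine key.trans_eq ?_
  field_simp
  ring

theorem sign_le_one (y : ℝ) : Real.sign y ≤ 1 := by
  rcases Real.sign_apply_eq y with h | h | h <;> rw [h] <;> norm_num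

theorem neg_sign_le_one (y : ℝ) : -Real.sign y ≤ 1 := by
  rcases Real.sign_apply_eq y with h | h | h <;> rw [h] <;> norm_num

theorem norm_chi (t q : ℝ) : ‖chi t q‖ = 1 := by
  have h := norm_cexp_I_mul_mul (-(Real.cos t / Real.sin t) * q / 2) q
  rw [chi, ← h]
  congr 2
  push_cast
  ring

/-- The expectation of `sgn Q(t)` in `ψ` is that of `± sgn P` in the state `χ_t⁻¹ ψ`. -/
theorem IsSgnQ.exists_fourier {t : ℝ} (ht : t ≠ 0) {A : L2 →L[ℂ] L2} (h : IsSgnQ t A) :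
    ∃ F : L2 ≃ₗᵢ[ℂ] L2, IsFourier F ∧ ∀ ψ : L2, ∃ v w : L2, ‖v‖ = ‖ψ‖ ∧
      (v =ᵐ[volume] fun q : ℝ => Complex.exp
        (-(Complex.I * (-(Real.cos t / Real.sin t) : ℝ) / 2) * (q : ℂ) ^ 2) * ψ q) ∧
      (w =ᵐ[volume] fun p => ((Real.sign (Real.sin t) * Real.sign p : ℝ) : ℂ) * F v p) ∧
      ⟪ψ, A ψ⟫_ℂ = ⟪F v, w⟫_ℂ := by
  rw [IsSgnQ, if_neg ht] at h
  obtain ⟨P, Mc, Mci, ⟨F, hF, hP⟩, hMc, hMci, rfl⟩ := h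
  refine ⟨F, hF, fun ψ => ⟨Mci ψ, ((Real.sign (Real.sin t) : ℝ) : ℂ) • F (P (Mci ψ)),
    ?_, ?_, ?_, ?_⟩⟩
  · have he : ‖Mci ψ‖ₑ = ‖ψ‖ₑ := by
      rw [Lp.enorm_def, Lp.enorm_def]
      refine eLpNorm_congr_norm_ae ?_
      filter_upwards [hMci ψ] with q hq
      rw [hq, norm_mul, norm_inv, norm_chi, inv_one, one_mul]
    rw [← toReal_enorm, he, toReal_enorm]
  · filter_upwards [hMci ψ] with q hq
    rw [hq, chi, ← Complex.exp_neg]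
    congr 2
    push_cast
    ring
  · filter_upwards [hP (Mci ψ), Lp.coeFn_smul ((Real.sign (Real.sin t) : ℝ) : ℂ)
      (F (P (Mci ψ)))] with p hp hs
    rw [hs, Pi.smul_apply, hp, smul_eq_mul, Complex.ofReal_mul, mul_assoc]
  · have hadj : ⟪ψ, Mc (P (Mci ψ))⟫_ℂ = ⟪Mci ψ, P (Mci ψ)⟫_ℂ := by
      rw [L2.inner_def, L2.inner_def]
      refine integral_congr_ae ?_
      filter_upwards [hMc (P (Mci ψ)), hMci ψ] with q hq hq'
      rw [hq, hq', RCLike.inner_apply, RCLike.inner_apply, map_mul,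
        Complex.inv_def, Complex.normSq_eq_norm_sq, norm_chi]
      simp
      ring
    rw [smul_apply, ContinuousLinearMap.comp_apply,
      ContinuousLinearMap.comp_apply, inner_smul_right, hadj, inner_smul_right, F.inner_map_map]

/-- With `E(t) := (1 + sgn Q(t))/2` (an orthogonal projection on `L²(ℝ)`)
for `t ∈ {0, 2π/3, 4π/3}`, the supremum over unit vectors `ψ` of
`(1/3)⟨ψ, (E(0) + E(2π/3) + E(4π/3))ψ⟩` is strictly less than `1`. -/
theorem sup_prob_lt_one (A0 A2 A4 : L2 →L[ℂ] L2)
    (h0 : IsSgnQ 0 A0) (h2 : IsSgnQ (2 * π / 3) A2) (h4 : IsSgnQ (4 * π / 3) A4) :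
    ∃ c : ℝ, c < 1 ∧ ∀ ψ : L2, ‖ψ‖ = 1 →
      (1 / 3 : ℝ) *
        (⟪ψ, (((2:ℂ)⁻¹ • (1 + A0)) + ((2:ℂ)⁻¹ • (1 + A2)) + ((2:ℂ)⁻¹ • (1 + A4))) ψ⟫_ℂ).re
        ≤ c := by
  have hs3 : 0 < √(3 : ℝ) := by positivity
  have hs3' : √(3 : ℝ) ^ 2 = 3 := Real.sq_sqrt (by norm_num)
  have e2 : 2 * π / 3 = π - π / 3 := by ring
  have e4 : 4 * π / 3 = π / 3 + π := by ring
  have hsin2 : Real.sin (2 * π / 3) = √3 / 2 := by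
    rw [e2, Real.sin_pi_sub, Real.sin_pi_div_three]
  have hcos2 : Real.cos (2 * π / 3) = -(1 / 2) := by
    rw [e2, Real.cos_pi_sub, Real.cos_pi_div_three]
  have hsin4 : Real.sin (4 * π / 3) = -(√3 / 2) := by
    rw [e4, Real.sin_add_pi, Real.sin_pi_div_three]
  have hcos4 : Real.cos (4 * π / 3) = -(1 / 2) := by
    rw [e4, Real.cos_add_pi, Real.cos_pi_div_three]
  have hcot2 : -(Real.cos (2 * π / 3) / Real.sin (2 * π / 3)) = 1 / √3 := by
    rw [hsin2, hcos2]
    field_simp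
  have hcot4 : -(Real.cos (4 * π / 3) / Real.sin (4 * π / 3)) = -(1 / √3) := by
    rw [hsin4, hcos4]
    field_simp
  obtain ⟨G, hG, h2⟩ := h2.exists_fourier (by positivity)
  obtain ⟨H, hH, h4⟩ := h4.exists_fourier (by positivity)
  rw [hcot2, hsin2, Real.sign_of_pos (by positivity)] at h2
  rw [hcot4, hsin4, Real.sign_of_neg (by linarith)] at h4
  rw [IsSgnQ, if_pos rfl] at h0
  set ε : ℝ := 3 * ((√π - 2 * (2 / 3 - (2 / 3) ^ 3 / 3)) / 2) + 2 * √π * (1 / √3) / π with hε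
  have hsp : 0 < √π := Real.sqrt_pos.2 Real.pi_pos
  have hεπ : ε < √π := by
    have hp1 : (1.77 : ℝ) < √π := Real.lt_sqrt_of_sq_lt (by linarith [Real.pi_gt_d2])
    have hp2 : √π < 1.78 := (Real.sqrt_lt' (by norm_num)).2 (by linarith [Real.pi_lt_d2])
    have h3 : (1.7 : ℝ) < √3 := Real.lt_sqrt_of_sq_lt (by norm_num)
    have h5 : 2 * √π * (1 / √3) / π = 2 / (√π * √3) := by
      field_simp
      rw [Real.sq_sqrt Real.pi_pos.le]
    have h6 : 2 / (√π * √3) < 2 / 3 := by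
      apply div_lt_div_of_pos_left <;> nlinarith
    rw [hε, h5]
    linarith
  refine ⟨1 - (1 - ε / √π) / 3, ?_, fun ψ hψ => ?_⟩
  · have : ε / √π < 1 := (div_lt_one hsp).2 hεπ
    linarith
  obtain ⟨v, v', hv, hvψ, hv', hi2⟩ := h2 ψ
  obtain ⟨w, w', hw, hwψ, hw', hi4⟩ := h4 ψ
  rw [hψ] at hv hw
  have key := sqrt_pi_le_of_three_halfPlanes hG hG hH (c := 1 / √3) (by positivity)
    (by rw [div_pow, hs3', one_pow]) hψ hv hw hvψ hwψ
  rw [← hε] at key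
  have i0 := re_inner_add_two_mul_le measurableSet_Iio sign_le_one
    (fun y hy => Real.sign_of_neg hy) (h0 ψ)
  have i2 := re_inner_add_two_mul_le (T := Set.Iio 0) measurableSet_Iio
    (fun y => by rw [one_mul]; exact sign_le_one y)
    (fun y hy => by rw [one_mul]; exact Real.sign_of_neg hy) hv'
  have i4 := re_inner_add_two_mul_le (T := Set.Ioi 0) measurableSet_Ioi
    (fun y => by rw [neg_one_mul]; exact neg_sign_le_one y)
    (fun y hy => by rw [neg_one_mul, Real.sign_of_pos hy]) hw'
  rw [← hi2, G.norm_map, hv] at i2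
  rw [← hi4, H.norm_map, hw] at i4
  rw [hψ] at i0
  have hexp : (⟪ψ, (((2:ℂ)⁻¹ • (1 + A0)) + ((2:ℂ)⁻¹ • (1 + A2)) +
      ((2:ℂ)⁻¹ • (1 + A4))) ψ⟫_ℂ).re =
      (3 + (⟪ψ, A0 ψ⟫_ℂ).re + (⟪ψ, A2 ψ⟫_ℂ).re + (⟪ψ, A4 ψ⟫_ℂ).re) / 2 := by
    have h2r : (2 : ℂ)⁻¹ = ((2⁻¹ : ℝ) : ℂ) := by norm_num
    simp only [add_apply, smul_apply,
      one_apply_eq_self, inner_add_right, inner_smul_right,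
      inner_self_eq_norm_sq_to_K, hψ, h2r, Complex.add_re, Complex.re_ofReal_mul]
    simp
    ring
  rw [hexp]
  have hdiv : 1 - ε / √π ≤ (∫⁻ y in Set.Iio 0, ‖ψ y‖ₑ ^ 2).toReal +
      (∫⁻ y in Set.Iio 0, ‖G v y‖ₑ ^ 2).toReal + (∫⁻ y in Set.Ioi 0, ‖H w y‖ₑ ^ 2).toReal := by
    rw [one_sub_div hsp.ne', div_le_iff₀ hsp]
    linarith
  linarith
end
end

section
/- Let θ(Q) := M_{1_{(0,∞)}} (multiplication by the indicator of (0,∞)) and θ(P) := 𝓕⁻¹ ∘ M_{1_{(0,∞)}} ∘ 𝓕, two orthogonal projections on L²(ℝ), and let T := θ(Q) + θ(P). Then the number 2 belongs to the spectrum of T (equivalently, sup over unit vectors ψ of ⟨ψ, Tψ⟩ equals 2), but 2 is not an eigenvalue of T. -/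
open MeasureTheory Complex Real
open scoped InnerProductSpace ComplexConjugate

noncomputable section

/-- The truncated exponential `q ↦ 1_s(q) e^{-aq}`. -/
def expOn (s : Set ℝ) (a : ℂ) : ℝ → ℂ :=
  s.indicator fun q : ℝ => Complex.exp (-a * (q : ℂ))

lemma measurable_cexp_neg_mul (a : ℂ) : Measurable fun q : ℝ => Complex.exp (-a * (q : ℂ)) :=
  (by fun_prop : Continuous fun q : ℝ => Complex.exp (-a * (q : ℂ))).measurable

lemma memLp_expOn {s : Set ℝ} {a : ℂ} (hs : MeasurableSet s)
    (h : IntegrableOn (fun q : ℝ => Complex.exp (-(2 * a) * (q : ℂ))) s) :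
    MemLp (expOn s a) 2 volume := by
  rw [expOn, memLp_indicator_iff_restrict hs,
    memLp_two_iff_integrable_sq_norm (measurable_cexp_neg_mul a).aestronglyMeasurable]
  refine h.norm.congr (Filter.Eventually.of_forall fun q => ?_)
  simp only [← norm_pow, ← Complex.exp_nat_mul]
  congr 2
  push_cast
  ring

lemma memLp_expOn_Ioi {a : ℂ} (ha : 0 < a.re) : MemLp (expOn (Set.Ioi 0) a) 2 volume :=
  memLp_expOn measurableSet_Ioi (integrableOn_exp_mul_complex_Ioi (by simpa using ha) 0)

lemma memLp_expOn_Iic {a : ℂ} (ha : a.re < 0) : MemLp (expOn (Set.Iic 0) a) 2 volume :=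
  memLp_expOn measurableSet_Iic
    (integrableOn_exp_mul_complex_Iic (by simpa using (by linarith : 2 * a.re < 0)) 0)

lemma IsFourier.ae_eq_of_memLp {F : L2 ≃ₗᵢ[ℂ] L2} (hF : IsFourier F) {f : ℝ → ℂ}
    (hf : MemLp f 2 volume) (hi : Integrable f volume) :
    (F (hf.toLp f) : ℝ → ℂ) =ᵐ[volume] fun p : ℝ => (((2 * π) ^ (-(1:ℝ)/2) : ℝ) : ℂ) *
      ∫ q : ℝ, Complex.exp (-(Complex.I) * (p : ℂ) * (q : ℂ)) * f q := by
  refine (hF _ (hi.congr hf.coeFn_toLp.symm)).trans (Filter.Eventually.of_forall fun p => ?_)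
  dsimp only
  congr 1
  refine integral_congr_ae ?_
  filter_upwards [hf.coeFn_toLp] with q hq
  rw [hq]

lemma integral_cexp_mul_expOn {s : Set ℝ} (hs : MeasurableSet s) (a : ℂ) (p : ℝ) :
    ∫ q : ℝ, Complex.exp (-(Complex.I) * (p : ℂ) * (q : ℂ)) * expOn s a q =
      ∫ q in s, Complex.exp (-(a + Complex.I * p) * (q : ℂ)) := by
  rw [← integral_indicator hs]
  congr 1 with q
  by_cases hq : q ∈ s
  · simp only [expOn, Set.indicator_of_mem hq, ← Complex.exp_add]
    congr 1
    ring
  · simp [expOn, hq]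

lemma IsFourier.expOn_Ioi {F : L2 ≃ₗᵢ[ℂ] L2} (hF : IsFourier F) {a : ℂ} (ha : 0 < a.re) :
    (F ((memLp_expOn_Ioi ha).toLp _) : ℝ → ℂ) =ᵐ[volume] fun p : ℝ =>
      (((2 * π) ^ (-(1:ℝ)/2) : ℝ) : ℂ) * (a + Complex.I * p)⁻¹ := by
  refine (hF.ae_eq_of_memLp (memLp_expOn_Ioi ha) ((integrable_indicator_iff measurableSet_Ioi).2
    (integrableOn_exp_mul_complex_Ioi (by simpa using ha) 0))).trans
    (Filter.Eventually.of_forall fun p => ?_)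
  dsimp only
  rw [integral_cexp_mul_expOn measurableSet_Ioi, integral_exp_mul_complex_Ioi (by simpa using ha)]
  simp [neg_div_neg_eq, -neg_add_rev]

lemma IsFourier.expOn_Iic {F : L2 ≃ₗᵢ[ℂ] L2} (hF : IsFourier F) {a : ℂ} (ha : a.re < 0) :
    (F ((memLp_expOn_Iic ha).toLp _) : ℝ → ℂ) =ᵐ[volume] fun p : ℝ =>
      (((2 * π) ^ (-(1:ℝ)/2) : ℝ) : ℂ) * -(a + Complex.I * p)⁻¹ := by
  refine (hF.ae_eq_of_memLp (memLp_expOn_Iic ha) ((integrable_indicator_iff measurableSet_Iic).2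
    (integrableOn_exp_mul_complex_Iic (by simpa using ha) 0))).trans
    (Filter.Eventually.of_forall fun p => ?_)
  dsimp only
  rw [integral_cexp_mul_expOn measurableSet_Iic, integral_exp_mul_complex_Iic (by simpa using ha)]
  simp [inv_neg, -neg_add_rev]

lemma inner_toLp_left {f : ℝ → ℂ} (hf : MemLp f 2 volume) (ψ : L2) :
    ⟪hf.toLp f, ψ⟫_ℂ = ∫ q, conj (f q) * ψ q := by
  rw [MeasureTheory.L2.inner_def]
  refine integral_congr_ae ?_
  filter_upwards [hf.coeFn_toLp] with q hq
  rw [hq, RCLike.inner_apply, mul_comm]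

/-- Plancherel pairing when the Fourier transform of the left argument is a simple pole. -/
lemma inner_eq_integral_pole {F : L2 ≃ₗᵢ[ℂ] L2} {e ψ : L2} {C a : ℂ}
    (he : (F e : ℝ → ℂ) =ᵐ[volume] fun p : ℝ => C * (a + Complex.I * p)⁻¹)
    (hg : ∀ᵐ p : ℝ, p ≤ 0 → (F ψ : ℝ → ℂ) p = 0) :
    ⟪e, ψ⟫_ℂ = conj C * Complex.I *
      ∫ p in Set.Ioi (0 : ℝ), F ψ p * ((p : ℂ) + Complex.I * conj a)⁻¹ := by
  rw [← F.inner_map_map, MeasureTheory.L2.inner_def, ← integral_const_mul,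
    ← integral_indicator measurableSet_Ioi]
  refine integral_congr_ae ?_
  filter_upwards [he, hg] with p hp hp0
  by_cases h : 0 < p
  · rw [hp, RCLike.inner_apply, Set.indicator_of_mem (Set.mem_Ioi.2 h)]
    have : conj (a + Complex.I * p) = -Complex.I * ((p : ℂ) + Complex.I * conj a) := by
      simp only [map_add, map_mul, conj_I, conj_ofReal]
      linear_combination conj a * Complex.I_sq
    simp only [map_mul, map_inv₀, this, mul_inv, inv_neg, Complex.inv_I, neg_neg]
    ring
  · rw [hp0 (not_lt.1 h), Set.indicator_of_notMem (by simpa using h)]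
    simp

lemma exists_mul_one_add_le_norm_add {w : ℂ} (hw : w ∈ Complex.slitPlane) :
    ∃ δ > 0, ∀ p : ℝ, 0 < p → δ * (1 + p) ≤ ‖(p : ℂ) + w‖ := by
  obtain ⟨d, hd, h⟩ : ∃ d > 0, ∀ p : ℝ, 0 < p → d ≤ ‖(p : ℂ) + w‖ := by
    rcases hw with h | h
    · refine ⟨w.re, h, fun p hp => ?_⟩
      have := (le_abs_self _).trans (Complex.abs_re_le_norm ((p : ℂ) + w))
      simp at this
      linarith
    · refine ⟨|w.im|, abs_pos.2 h, fun p hp => ?_⟩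
      simpa using Complex.abs_im_le_norm ((p : ℂ) + w)
  have hpos : 0 < d + 1 + ‖w‖ := by positivity
  refine ⟨d / (d + 1 + ‖w‖), by positivity, fun p hp => ?_⟩
  have h1 := h p hp
  have h2 : p ≤ ‖(p : ℂ) + w‖ + ‖w‖ := by
    have := norm_sub_le ((p : ℂ) + w) w
    simpa [abs_of_pos hp] using this
  rw [div_mul_eq_mul_div, div_le_iff₀ hpos]
  nlinarith [norm_nonneg w]

lemma memLp_one_add_inv : MemLp (fun p : ℝ => (1 + p)⁻¹) 2 (volume.restrict (Set.Ioi 0)) := by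
  have hm : Measurable fun p : ℝ => (1 + p)⁻¹ := by fun_prop
  rw [memLp_two_iff_integrable_sq hm.aestronglyMeasurable]
  refine (integrable_inv_one_add_sq.integrableOn (s := Set.Ioi 0)).mono'
    (hm.pow_const 2).aestronglyMeasurable ?_
  filter_upwards [ae_restrict_mem measurableSet_Ioi] with p hp
  have hp : 0 < p := hp
  rw [Real.norm_of_nonneg (by positivity), inv_pow]
  gcongr
  nlinarith

/-- The Cauchy transform of an `L²` function on the half-line is holomorphic off the cut. -/
lemma differentiableAt_cauchy (g : L2) {w : ℂ} (hw : w ∈ Complex.slitPlane) :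
    DifferentiableAt ℂ (fun w : ℂ => ∫ p in Set.Ioi (0 : ℝ), g p * ((p : ℂ) + w)⁻¹) w := by
  obtain ⟨δ, hδ, h⟩ := exists_mul_one_add_le_norm_add hw
  have hgm : AEStronglyMeasurable g (volume.restrict (Set.Ioi 0)) :=
    (Lp.aestronglyMeasurable g).restrict
  have hb : Integrable (fun p : ℝ => ‖g p‖ * (1 + p)⁻¹) (volume.restrict (Set.Ioi 0)) :=
    ((Lp.memLp g).restrict _).norm.integrable_mul memLp_one_add_inv
  have hball : ∀ p : ℝ, 0 < p → ∀ x ∈ Metric.ball w (δ / 2), δ / 2 * (1 + p) ≤ ‖(p : ℂ) + x‖ := by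
    intro p hp x hx
    have h1 := norm_sub_norm_le ((p : ℂ) + w) (w - x)
    rw [show (p : ℂ) + w - (w - x) = p + x by ring, ← dist_eq_norm, dist_comm] at h1
    have := h p hp
    have := Metric.mem_ball.1 hx
    nlinarith
  have hne : ∀ p : ℝ, 0 < p → ∀ x ∈ Metric.ball w (δ / 2), (p : ℂ) + x ≠ 0 := by
    intro p hp x hx
    have := hball p hp x hx
    exact norm_pos_iff.1 (lt_of_lt_of_le (by positivity) this)
  have hw0 : w ∈ Metric.ball w (δ / 2) := Metric.mem_ball_self (by positivity)
  have hm : ∀ x : ℂ, Measurable fun p : ℝ => ((p : ℂ) + x)⁻¹ := fun x => by fun_prop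
  refine (hasDerivAt_integral_of_dominated_loc_of_deriv_le
    (F' := fun x p => g p * (-1 / ((p : ℂ) + x) ^ 2))
    (bound := fun p => (δ / 2)⁻¹ ^ 2 * (‖g p‖ * (1 + p)⁻¹))
    (Metric.ball_mem_nhds w (by positivity : 0 < δ / 2))
    (Filter.Eventually.of_forall fun x => hgm.mul (hm x).aestronglyMeasurable) ?_ ?_ ?_
    (hb.const_mul _) ?_).2.differentiableAt
  · refine (hb.const_mul (δ / 2)⁻¹).mono' (hgm.mul (hm w).aestronglyMeasurable) ?_
    filter_upwards [ae_restrict_mem measurableSet_Ioi] with p hp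
    have hp : 0 < p := hp
    have := hball p hp w hw0
    rw [Pi.mul_apply, norm_mul, norm_inv, mul_left_comm, ← mul_inv]
    gcongr
  · exact hgm.mul (by fun_prop : Measurable fun p : ℝ => -1 / ((p : ℂ) + w) ^ 2).aestronglyMeasurable
  · filter_upwards [ae_restrict_mem measurableSet_Ioi] with p hp x hx
    have hp : 0 < p := hp
    have := hball p hp x hx
    rw [norm_mul, norm_div, norm_neg, norm_one, norm_pow, one_div, ← inv_pow, mul_left_comm]
    gcongr
    calc ‖(p : ℂ) + x‖⁻¹ ^ 2 ≤ (δ / 2 * (1 + p))⁻¹ ^ 2 := by gcongr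
      _ = (δ / 2)⁻¹ ^ 2 * ((1 + p)⁻¹ * (1 + p)⁻¹) := by rw [mul_inv]; ring
      _ ≤ (δ / 2)⁻¹ ^ 2 * (1 * (1 + p)⁻¹) := by
        gcongr
        exact inv_le_one_of_one_le₀ (by linarith)
      _ = _ := by ring
  · filter_upwards [ae_restrict_mem measurableSet_Ioi] with p hp x hx
    have := ((hasDerivAt_id x).const_add (p : ℂ)).inv (hne p hp x hx)
    exact this.const_mul (g p)

/-- A function supported on the half-line whose Fourier transform is also supported there
vanishes. -/
lemma IsFourier.eq_zero_of_half_line {F : L2 ≃ₗᵢ[ℂ] L2} (hF : IsFourier F) {ψ : L2}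
    (hψ : ∀ᵐ q : ℝ, q ≤ 0 → ψ q = 0) (hg : ∀ᵐ p : ℝ, p ≤ 0 → (F ψ : ℝ → ℂ) p = 0) :
    ψ = 0 := by
  have hC : (((2 * π) ^ (-(1:ℝ)/2) : ℝ) : ℂ) ≠ 0 :=
    Complex.ofReal_ne_zero.2 (Real.rpow_pos_of_pos (by positivity) _).ne'
  set h : ℂ → ℂ := fun w => ∫ p in Set.Ioi (0 : ℝ), F ψ p * ((p : ℂ) + w)⁻¹ with hh
  have hlow : ∀ w : ℂ, w.im < 0 → h w = 0 := by
    intro w hw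
    have ha : (Complex.I * conj w).re < 0 := by simpa using hw
    have h1 : ⟪(memLp_expOn_Iic ha).toLp _, ψ⟫_ℂ = 0 := by
      rw [inner_toLp_left]
      refine integral_eq_zero_of_ae ?_
      filter_upwards [hψ] with q hq
      by_cases h0 : q ≤ 0
      · simp [hq h0]
      · simp [expOn, h0]
    rw [inner_eq_integral_pole (F := F) (a := Complex.I * conj w)
      (C := -(((2 * π) ^ (-(1:ℝ)/2) : ℝ) : ℂ))
      (by simpa only [neg_mul, mul_neg] using hF.expOn_Iic ha) hg] at h1
    have h2 : Complex.I * conj (Complex.I * conj w) = w := by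
      simp only [map_mul, conj_I, conj_conj]
      linear_combination (-w) * Complex.I_sq
    rw [h2] at h1
    simpa [hC] using h1
  have han : AnalyticOnNhd ℂ h Complex.slitPlane :=
    DifferentiableOn.analyticOnNhd
      (fun w hw => (differentiableAt_cauchy _ hw).differentiableWithinAt)
      Complex.isOpen_slitPlane
  have hzero : Set.EqOn h 0 Complex.slitPlane := by
    refine han.eqOn_zero_of_preconnected_of_eventuallyEq_zero
      (StarConvex.isPathConnected Complex.starConvex_one_slitPlane
        Complex.one_mem_slitPlane).isConnected.isPreconnected (z₀ := -Complex.I)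
      (by simp [Complex.mem_slitPlane_iff]) ?_
    filter_upwards [(isOpen_lt Complex.continuous_im continuous_const).mem_nhds
      (by simp : (-Complex.I).im < 0)] with w hw using hlow w hw
  have hup : ∀ (a : ℂ) (ha : 0 < a.re), ⟪(memLp_expOn_Ioi ha).toLp _, ψ⟫_ℂ = 0 := by
    intro a ha
    rw [inner_eq_integral_pole (hF.expOn_Ioi ha) hg]
    have : h (Complex.I * conj a) = 0 := hzero (by
      rw [Complex.mem_slitPlane_iff]; right; simpa using ha.ne')
    simp only [hh] at this
    rw [this, mul_zero]
  set f : ℝ → ℂ := fun q => expOn (Set.Ioi 0) 1 q * ψ q with hf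
  have hem : MemLp (expOn (Set.Ioi 0) 1) 2 volume := memLp_expOn_Ioi (by simp)
  have hfi : Integrable f volume := hem.integrable_mul (Lp.memLp ψ)
  have hf2 : MemLp f 2 volume := by
    refine (Lp.memLp ψ).of_le hfi.aestronglyMeasurable (Filter.Eventually.of_forall fun q => ?_)
    rw [hf, norm_mul]
    refine mul_le_of_le_one_left (norm_nonneg _) ?_
    by_cases h0 : 0 < q
    · simp [expOn, h0, Complex.norm_exp, h0.le]
    · simp [expOn, h0]
  have hf0 : F (hf2.toLp f) = 0 := by
    rw [Lp.eq_zero_iff_ae_eq_zero]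
    filter_upwards [hF.ae_eq_of_memLp hf2 hfi] with p hp
    have ha : 0 < (1 - Complex.I * p : ℂ).re := by simp
    have h1 := hup _ ha
    rw [inner_toLp_left] at h1
    rw [hp, Pi.zero_apply, ← mul_zero (((2 * π) ^ (-(1:ℝ)/2) : ℝ) : ℂ), ← h1]
    congr 1
    refine integral_congr_ae (Filter.Eventually.of_forall fun q => ?_)
    by_cases h0 : 0 < q
    · simp only [hf, expOn, Set.indicator_of_mem (Set.mem_Ioi.2 h0), ← mul_assoc,
        ← Complex.exp_add, ← Complex.exp_conj]
      congr 2
      simp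
      ring
    · simp [hf, expOn, h0]
  have hf0' : hf2.toLp f = 0 := by simpa using hf0
  rw [Lp.eq_zero_iff_ae_eq_zero] at hf0' ⊢
  filter_upwards [hf0', hf2.coeFn_toLp, hψ] with q h1 h2 h3
  by_cases h0 : 0 < q
  · rw [h1] at h2
    simpa [hf, expOn, h0] using h2.symm
  · exact h3 (not_lt.1 h0)

lemma norm_sq_eq_integral (f : L2) : ‖f‖ ^ 2 = ∫ x, ‖f x‖ ^ 2 := by
  have h := congrArg RCLike.re (MeasureTheory.L2.inner_def (𝕜 := ℂ) f f)
  rw [inner_self_eq_norm_sq, ← integral_re (MeasureTheory.L2.integrable_inner f f)] at h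
  simpa only [inner_self_eq_norm_sq] using h

lemma eq_of_add_eq_two_smul {x y z : L2} (hx : ‖x‖ ≤ ‖z‖) (hy : ‖y‖ ≤ ‖z‖)
    (h : x + y = (2 : ℂ) • z) : x = z ∧ y = z := by
  have h1 := parallelogram_law_with_norm ℂ x y
  rw [h, norm_smul, Complex.norm_ofNat] at h1
  have h2 : ‖x - y‖ ^ 2 ≤ 0 := by nlinarith [norm_nonneg x, norm_nonneg y]
  have h3 : x = y := sub_eq_zero.1 (norm_eq_zero.1 (by nlinarith [norm_nonneg (x - y)]))
  subst h3
  rw [← two_smul ℂ x] at h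
  have := smul_right_injective L2 (two_ne_zero (α := ℂ)) h
  exact ⟨this, this⟩

lemma norm_le_of_ae_eq_ite_mul {f g : L2}
    (h : (f : ℝ → ℂ) =ᵐ[volume] fun q => (if 0 < q then (1 : ℂ) else 0) * g q) : ‖f‖ ≤ ‖g‖ := by
  refine Lp.norm_le_norm_of_ae_le ?_
  filter_upwards [h] with q hq
  rw [hq]
  split_ifs <;> simp

lemma norm_expOn_Ioi_sq {a : ℂ} (ha : 0 < a.re) :
    ‖(memLp_expOn_Ioi ha).toLp _‖ ^ 2 = ∫ q in Set.Ioi (0 : ℝ), Real.exp (-(2 * a.re) * q) := by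
  rw [norm_sq_eq_integral, ← integral_indicator measurableSet_Ioi]
  refine integral_congr_ae ?_
  filter_upwards [(memLp_expOn_Ioi ha).coeFn_toLp] with q hq
  rw [hq]
  by_cases h0 : 0 < q
  · simp only [expOn, Set.indicator_of_mem (Set.mem_Ioi.2 h0), Complex.norm_exp, ← Real.exp_nat_mul]
    congr 1
    simp
    ring
  · simp [expOn, h0]

lemma tendsto_integral_Iic_inv_one_add_sub_sq :
    Filter.Tendsto (fun n : ℕ => ∫ p in Set.Iic (0 : ℝ), (1 + (p - n) ^ 2)⁻¹) Filter.atTop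
      (nhds 0) := by
  have h : ∀ n : ℕ, ∫ p in Set.Iic (0 : ℝ), (1 + (p - n) ^ 2)⁻¹ =
      Real.arctan (-n) + π / 2 := by
    intro n
    have := (measurePreserving_sub_right volume (n : ℝ)).setIntegral_preimage_emb
      (MeasurableEquiv.subRight (n : ℝ)).measurableEmbedding (fun x : ℝ => (1 + x ^ 2)⁻¹)
      (Set.Iic (-n))
    rwa [Set.preimage_sub_const_Iic, neg_add_cancel, integral_Iic_inv_one_add_sq] at this
  simp only [h]
  have := (Real.tendsto_arctan_atBot.mono_right nhdsWithin_le_nhds).comp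
    (Filter.tendsto_neg_atTop_atBot.comp (tendsto_natCast_atTop_atTop (R := ℝ)))
  simpa using this.add_const (π / 2)

lemma tendsto_norm_sub_proj {F : L2 ≃ₗᵢ[ℂ] L2} {thP : L2 →L[ℂ] L2}
    (hP : ∀ ψ : L2, (F (thP ψ) : ℝ → ℂ) =ᵐ[volume]
      fun p => (if 0 < p then (1 : ℂ) else 0) * (F ψ : ℝ → ℂ) p)
    {e : ℕ → L2} (he : ∀ n, (F (e n) : ℝ → ℂ) =ᵐ[volume] fun p : ℝ =>
      (((2 * π) ^ (-(1:ℝ)/2) : ℝ) : ℂ) * ((1 - Complex.I * n) + Complex.I * p)⁻¹) :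
    Filter.Tendsto (fun n => ‖e n - thP (e n)‖ ^ 2) Filter.atTop (nhds 0) := by
  have h : ∀ n, ‖e n - thP (e n)‖ ^ 2 =
      ((2 * π) ^ (-(1:ℝ)/2)) ^ 2 * ∫ p in Set.Iic (0 : ℝ), (1 + (p - n) ^ 2)⁻¹ := by
    intro n
    rw [← F.norm_map, map_sub, norm_sq_eq_integral, ← integral_const_mul,
      ← integral_indicator measurableSet_Iic]
    refine integral_congr_ae ?_
    filter_upwards [Lp.coeFn_sub (F (e n)) (F (thP (e n))), he n, hP (e n)] with p h1 h2 h3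
    rw [h1, Pi.sub_apply, h3, h2]
    by_cases h0 : 0 < p
    · simp [h0]
    · rw [Set.indicator_of_mem (by simpa using h0), if_neg h0, zero_mul, sub_zero, norm_mul,
        mul_pow, norm_inv, inv_pow, Complex.norm_real, Real.norm_eq_abs, sq_abs,
        ← Complex.normSq_eq_norm_sq]
      congr 2
      simp [Complex.normSq_apply]
      ring
  simp only [h]
  simpa using tendsto_integral_Iic_inv_one_add_sub_sq.const_mul (((2 * π) ^ (-(1:ℝ)/2)) ^ 2)

/-- With `θ(Q) := M_{1_{(0,∞)}}`, `θ(P) := 𝓕⁻¹ ∘ M_{1_{(0,∞)}} ∘ 𝓕` and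
`T := θ(Q) + θ(P)`, the number `2` belongs to the spectrum of `T` but is not an
eigenvalue of `T`. -/
theorem two_in_spectrum_not_eigenvalue (F : L2 ≃ₗᵢ[ℂ] L2) (thQ thP : L2 →L[ℂ] L2)
    (hF : IsFourier F)
    (hQ : IsMulOp (fun q => if 0 < q then (1 : ℂ) else 0) thQ)
    (hP : ∀ ψ : L2, (F (thP ψ) : ℝ → ℂ) =ᵐ[volume]
      fun p => (if 0 < p then (1 : ℂ) else 0) * (F ψ : ℝ → ℂ) p) :
    (2 : ℂ) ∈ spectrum ℂ (thQ + thP) ∧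
    ¬ ∃ ψ : L2, ψ ≠ 0 ∧ (thQ + thP) ψ = (2 : ℂ) • ψ := by
  constructor
  · rw [spectrum.mem_iff]
    intro hu
    obtain ⟨S, hS⟩ := hu.exists_left_inv
    have hre : ∀ n : ℕ, 0 < (1 - Complex.I * n : ℂ).re := fun n => by simp
    set e : ℕ → L2 := fun n => (memLp_expOn_Ioi (hre n)).toLp _ with he
    have hlim := tendsto_norm_sub_proj hP (e := e) (fun n => hF.expOn_Ioi (hre n))
    have hQe : ∀ n, thQ (e n) = e n := by
      intro n
      refine Lp.ext ?_
      filter_upwards [hQ (e n), (memLp_expOn_Ioi (hre n)).coeFn_toLp] with q h1 h2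
      rw [h1]
      by_cases h0 : 0 < q
      · simp [h0]
      · rw [if_neg h0, zero_mul]
        exact (h2.trans (by simp [expOn, h0])).symm
    have hbound : ∀ n, ‖e n‖ ^ 2 ≤ ‖S‖ ^ 2 * ‖e n - thP (e n)‖ ^ 2 := by
      intro n
      have h1 : S (e n - thP (e n)) = e n := by
        have h2 : (algebraMap ℂ (L2 →L[ℂ] L2) 2 - (thQ + thP)) (e n) = e n - thP (e n) := by
          change (algebraMap ℂ (L2 →L[ℂ] L2) 2) (e n) - (thQ (e n) + thP (e n)) = _
          rw [Algebra.algebraMap_eq_smul_one, hQe]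
          change (2 : ℂ) • e n - _ = _
          rw [two_smul]
          abel
        rw [← h2]
        exact DFunLike.congr_fun hS (e n)
      rw [← mul_pow]
      gcongr
      conv_lhs => rw [← h1]
      exact S.le_opNorm _
    have hnorm : ∀ n, ‖e n‖ ^ 2 = 1 / 2 := by
      intro n
      rw [norm_expOn_Ioi_sq (hre n)]
      have := integral_exp_mul_Ioi (a := -2) (by norm_num) 0
      simpa using this
    have := ge_of_tendsto (hlim.const_mul (‖S‖ ^ 2))
      (Filter.Eventually.of_forall fun n => (hnorm n).symm.le.trans (hbound n))
    norm_num at this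
  · rintro ⟨ψ, hψ0, hψ⟩
    obtain ⟨h1, h2⟩ : thQ ψ = ψ ∧ thP ψ = ψ :=
      eq_of_add_eq_two_smul (norm_le_of_ae_eq_ite_mul (hQ ψ))
        (by simpa using norm_le_of_ae_eq_ite_mul (hP ψ)) hψ
    refine hψ0 (hF.eq_zero_of_half_line ?_ ?_)
    · have := hQ ψ
      rw [h1] at this
      filter_upwards [this] with q hq h0
      simpa [not_lt.2 h0] using hq
    · have := hP ψ
      rw [h2] at this
      filter_upwards [this] with q hq h0
      simpa [not_lt.2 h0] using hq
end
end
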